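/- The graphon mean field flow depends Lipschitz-continuously on its initial condition: let φ(·, x₀) denote the unique probability-vector-valued solution of φ(t, x₀) = x₀ + ∫₀ᵗ F^G(φ(τ, x₀)) dτ, and let L_F := 2(C_R|S|² + 2 C_R|S|³ |||G|||). Then for all measurable x₀, y₀ : (0,1] → ℝ^S that are probability vectors on S for almost every u, and all t ≥ 0: ‖φ(t, x₀) − φ(t, y₀)‖_{L₂} ≤ e^{L_F t} ‖x₀ − y₀‖_{L₂}. -/

import Mathlib

open MeasureTheory Set Filter

/-- The `L₂` norm of a measurable family `x : (0,1] → ℝ^S`,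
`‖x‖ = √(∑ s ∫₀¹ x(u,s)² du)`. -/
noncomputable def l2norm {S : Type*} [Fintype S] (x : ℝ → S → ℝ) : ℝ :=
  Real.sqrt (∑ s, ∫ u in Ioc (0:ℝ) 1, (x u s) ^ 2)

/-- The `L₂` operator norm `|||G|||` of a kernel `G : (0,1]² → ℝ`. -/
noncomputable def graphonOpNorm (G : ℝ → ℝ → ℝ) : ℝ :=
  sSup {r : ℝ | ∃ f : ℝ → ℝ, Measurable f ∧ (∫ v in Ioc (0:ℝ) 1, (f v) ^ 2) ≤ 1 ∧
    r = Real.sqrt (∫ u in Ioc (0:ℝ) 1, (∫ v in Ioc (0:ℝ) 1, G u v * f v) ^ 2)}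

/-- The graphon drift
`F^G_{u,s}(x) = R^uni_{u,s}·x_u + x_uᵀ (∫₀¹ R^pair_{u,v,s} G(u,v) x_v dv)`. -/
noncomputable def graphonDrift {S : Type*} [Fintype S]
    (G : ℝ → ℝ → ℝ) (Runi : ℝ → S → S → ℝ) (Rpair : ℝ → ℝ → S → S → S → ℝ)
    (x : ℝ → S → ℝ) (u : ℝ) (s : S) : ℝ :=
  (∑ s', Runi u s s' * x u s') +
    ∑ s', x u s' * ∫ v in Ioc (0:ℝ) 1, ∑ sl, Rpair u v s s' sl * G u v * x v sl


/-- The unilateral rate vector `R^uni_{u,s}` built from rate functions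
`r^uni_u(s → s')`: its `s'`-component is `r^uni_u(s' → s)` for `s' ≠ s` and
`−∑_{s̃ ≠ s} r^uni_u(s → s̃)` for `s' = s`. -/
noncomputable def RuniOf {S : Type*} [Fintype S] [DecidableEq S]
    (runi : ℝ → S → S → ℝ) (u : ℝ) (s s' : S) : ℝ :=
  if s' = s then -(∑ st ∈ Finset.univ.erase s, runi u s st) else runi u s' s

/-- The pairwise rate matrix `R^pair_{u,v,s}` built from rate functions
`r^pair_{u,v}(s → s', s_l)`. -/
noncomputable def RpairOf {S : Type*} [Fintype S] [DecidableEq S]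
    (rpair : ℝ → ℝ → S → S → S → ℝ) (u v : ℝ) (s s' sl : S) : ℝ :=
  if s' = s then -(∑ st ∈ Finset.univ.erase s, rpair u v s st sl) else rpair u v s' s sl

/-- `φ` is a solution of the graphon mean field equation with initial condition `x₀`:
it is measurable, probability-vector valued (a.e.), satisfies the integral equation
`φ(t) = x₀ + ∫₀ᵗ F^G(φ(τ)) dτ` in `L₂`, and is continuous in time for the `L₂` norm. -/
def IsMFSolution {S : Type*} [Fintype S]
    (G : ℝ → ℝ → ℝ) (Runi : ℝ → S → S → ℝ) (Rpair : ℝ → ℝ → S → S → S → ℝ)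
    (x₀ : ℝ → S → ℝ) (φ : ℝ → ℝ → S → ℝ) : Prop :=
  (∀ s, Measurable fun p : ℝ × ℝ => φ p.1 p.2 s) ∧
  (∀ t, 0 ≤ t → ∀ᵐ u ∂(volume.restrict (Ioc (0:ℝ) 1)),
      (∀ s, 0 ≤ φ t u s) ∧ ∑ s, φ t u s = 1) ∧
  (∀ t, 0 ≤ t → ∀ᵐ u ∂(volume.restrict (Ioc (0:ℝ) 1)), ∀ s,
      φ t u s = x₀ u s + ∫ τ in Ioc (0:ℝ) t, graphonDrift G Runi Rpair (φ τ) u s) ∧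
  (∀ t₀, 0 ≤ t₀ → Filter.Tendsto (fun t => l2norm (fun u s => φ t u s - φ t₀ u s))
      (nhdsWithin t₀ (Ici (0:ℝ))) (nhds 0))



def BddMeas {α : Type*} [MeasurableSpace α] (f : α → ℝ) : Prop :=
  Measurable f ∧ ∃ M : ℝ, ∀ x, |f x| ≤ M

namespace BddMeas
variable {α β : Type*} [MeasurableSpace α] [MeasurableSpace β]

lemma add {f g : α → ℝ} (hf : BddMeas f) (hg : BddMeas g) : BddMeas (fun x => f x + g x) := by
  obtain ⟨hf, M, hM⟩ := hf
  obtain ⟨hg, N, hN⟩ := hg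
  exact ⟨hf.add hg, M + N, fun x => (abs_add_le _ _).trans (add_le_add (hM x) (hN x))⟩

lemma neg {f : α → ℝ} (hf : BddMeas f) : BddMeas (fun x => - f x) := by
  obtain ⟨hf, M, hM⟩ := hf
  exact ⟨hf.neg, M, fun x => by rw [abs_neg]; exact hM x⟩

lemma sub {f g : α → ℝ} (hf : BddMeas f) (hg : BddMeas g) : BddMeas (fun x => f x - g x) := by
  simpa only [sub_eq_add_neg] using hf.add hg.neg

lemma mul {f g : α → ℝ} (hf : BddMeas f) (hg : BddMeas g) : BddMeas (fun x => f x * g x) := by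
  obtain ⟨hf, M, hM⟩ := hf
  obtain ⟨hg, N, hN⟩ := hg
  refine ⟨hf.mul hg, M * N, fun x => ?_⟩
  rw [abs_mul]
  exact mul_le_mul (hM x) (hN x) (abs_nonneg _) ((abs_nonneg _).trans (hM x))

lemma const (c : ℝ) : BddMeas (fun _ : α => c) := ⟨measurable_const, |c|, fun _ => le_rfl⟩

lemma sq {f : α → ℝ} (hf : BddMeas f) : BddMeas (fun x => f x ^ 2) := by
  simpa only [pow_two] using hf.mul hf

lemma sum {ι : Type*} {s : Finset ι} {f : ι → α → ℝ} (hf : ∀ i, BddMeas (f i)) :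
    BddMeas (fun x => ∑ i ∈ s, f i x) := by
  choose hm M hM using hf
  refine ⟨Finset.measurable_fun_sum _ fun i _ => hm i, ∑ i ∈ s, M i, fun x => ?_⟩
  exact (Finset.abs_sum_le_sum_abs _ _).trans (Finset.sum_le_sum fun i _ => hM i x)

lemma comp {f : α → ℝ} (hf : BddMeas f) {g : β → α} (hg : Measurable g) :
    BddMeas (fun x => f (g x)) :=
  ⟨hf.1.comp hg, hf.2.imp fun _ h x => h (g x)⟩

lemma integrable {f : α → ℝ} (hf : BddMeas f) (μ : Measure α) [IsFiniteMeasure μ] :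
    Integrable f μ := by
  obtain ⟨hf, M, hM⟩ := hf
  exact Integrable.of_bound hf.aestronglyMeasurable M (Eventually.of_forall hM)

lemma integral {f : α × β → ℝ} (hf : BddMeas f) (ν : Measure β) [IsFiniteMeasure ν] :
    BddMeas (fun x => ∫ y, f (x, y) ∂ν) := by
  obtain ⟨hf, M, hM⟩ := hf
  refine ⟨(hf.stronglyMeasurable.integral_prod_right').measurable, M * ν.real univ, fun x => ?_⟩
  exact norm_integral_le_of_norm_le_const (f := fun y => f (x, y))
    (Eventually.of_forall fun y => hM (x, y))
end BddMeas

lemma amgm {l : ℝ} (hl : 0 < l) (a b : ℝ) : |a| * |b| ≤ (l * a ^ 2 + b ^ 2 / l) / 2 := by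
  have h : l * a ^ 2 + b ^ 2 / l - 2 * (|a| * |b|) = (l * |a| - |b|) ^ 2 / l := by
    field_simp
    rw [← sq_abs a, ← sq_abs b]; ring
  have : 0 ≤ (l * |a| - |b|) ^ 2 / l := by positivity
  linarith

lemma opt {X L A B : ℝ} (hL : 0 ≤ L) (hA : 0 ≤ A) (hB : 0 ≤ B)
    (h : ∀ l : ℝ, 0 < l → X ≤ L * ((l * A + B / l) / 2)) : X ≤ L * (√A * √B) := by
  have key : ∀ e : ℝ, 0 < e → X ≤ L * ((√A + e) * (√B + e)) := by
    intro e he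
    have hA' := Real.sqrt_nonneg A
    have hB' := Real.sqrt_nonneg B
    have h1 : 0 < √A + e := by linarith
    have h2 : 0 < √B + e := by linarith
    refine (h ((√B + e) / (√A + e)) (by positivity)).trans (mul_le_mul_of_nonneg_left ?_ hL)
    have e1 : (√B + e) / (√A + e) * A ≤ (√B + e) * (√A + e) := by
      rw [div_mul_eq_mul_div, div_le_iff₀ h1, mul_assoc]
      refine mul_le_mul_of_nonneg_left ?_ h2.le
      nlinarith [Real.sq_sqrt hA]
    have e2 : B / ((√B + e) / (√A + e)) ≤ (√B + e) * (√A + e) := by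
      rw [div_div_eq_mul_div, div_le_iff₀ h2]
      have : B ≤ (√B + e) * (√B + e) := by nlinarith [Real.sq_sqrt hB]
      nlinarith
    linarith
  have ht : Tendsto (fun e : ℝ => L * ((√A + e) * (√B + e))) (nhdsWithin 0 (Ioi 0))
      (nhds (L * (√A * √B))) := by
    have : Continuous (fun e : ℝ => L * ((√A + e) * (√B + e))) := by fun_prop
    have h := (this.tendsto 0).mono_left (nhdsWithin_le_nhds (s := Ioi (0:ℝ)))
    simpa using h
  exact ge_of_tendsto ht (by filter_upwards [self_mem_nhdsWithin] with e he using key e he)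

section
variable {S : Type*} [Fintype S] [DecidableEq S]

noncomputable def cc (s s' : S) : ℝ := if s' = s then (Fintype.card S : ℝ) - 1 else 1

lemma card_one_le (s : S) : (1:ℝ) ≤ Fintype.card S := by
  have : Nonempty S := ⟨s⟩
  exact_mod_cast Fintype.card_pos

lemma cc_nonneg (s s' : S) : 0 ≤ cc s s' := by
  unfold cc
  have := card_one_le s
  split_ifs <;> linarith

lemma cc_le (s s' : S) : cc s s' ≤ Fintype.card S := by
  unfold cc
  have := card_one_le s
  split_ifs <;> linarith

lemma cc_row (s : S) : ∑ s', cc s s' = 2 * ((Fintype.card S : ℝ) - 1) := by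
  have : ∀ s', cc s s' = 1 + if s' = s then (Fintype.card S : ℝ) - 2 else 0 := by
    intro s'; unfold cc; split_ifs <;> ring
  simp only [this, Finset.sum_add_distrib, Finset.sum_ite_eq', Finset.mem_univ, if_true]
  simp; ring

lemma cc_symm (s s' : S) : cc s s' = cc s' s := by
  unfold cc; simp [eq_comm]

/-- pointwise kernel of the drift -/
noncomputable def kk (A : S → S → ℝ) (B : S → S → S → ℝ) (x y : S → ℝ) (s : S) : ℝ :=
  (∑ s', A s s' * x s') + ∑ s', x s' * ∑ sl, B s s' sl * y sl

lemma kk_sub (A : S → S → ℝ) (B : S → S → S → ℝ) (x y x' y' : S → ℝ) (s : S) :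
    kk A B x x' s - kk A B y y' s =
      (∑ s', (A s s' + ∑ sl, B s s' sl * x' sl) * (x s' - y s')) +
      ∑ s', y s' * ∑ sl, B s s' sl * (x' sl - y' sl) := by
  unfold kk
  simp only [mul_sub, Finset.sum_sub_distrib, add_mul, Finset.sum_add_distrib, mul_comm (x _),
    mul_comm (y _), sub_mul]
  ring

lemma kk_bound {C : ℝ} (hC : 0 ≤ C) (A : S → S → ℝ) (B : S → S → S → ℝ)
    (hA : ∀ s s', |A s s'| ≤ C * cc s s') (hB : ∀ s s' sl, |B s s' sl| ≤ C * cc s s')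
    (g x y x' y' : S → ℝ) (hy : (∀ s, 0 ≤ y s) ∧ ∑ s, y s = 1)
    (hx' : (∀ s, 0 ≤ x' s) ∧ ∑ s, x' s = 1) {l : ℝ} (hl : 0 < l) :
    ∑ s, g s * (kk A B x x' s - kk A B y y' s) ≤
      (4 * C * ((Fintype.card S : ℝ) - 1)) *
        ((l * ∑ s, g s ^ 2 + (∑ s, (x s - y s) ^ 2) / l) / 2) +
      (C * (Fintype.card S : ℝ) ^ 2) *
        ((l * ∑ s, g s ^ 2 + (∑ s, (x' s - y' s) ^ 2) / l) / 2) := by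
  set n : ℝ := (Fintype.card S : ℝ) with hn
  have h1 : ∀ s s', |A s s' + ∑ sl, B s s' sl * x' sl| ≤ 2 * C * cc s s' := by
    intro s s'
    have : |∑ sl, B s s' sl * x' sl| ≤ C * cc s s' := by
      calc |∑ sl, B s s' sl * x' sl| ≤ ∑ sl, |B s s' sl * x' sl| := Finset.abs_sum_le_sum_abs _ _
        _ ≤ ∑ sl, C * cc s s' * x' sl := by
          refine Finset.sum_le_sum fun sl _ => ?_
          rw [abs_mul, abs_of_nonneg (hx'.1 sl)]
          exact mul_le_mul_of_nonneg_right (hB _ _ _) (hx'.1 sl)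
        _ = C * cc s s' := by rw [← Finset.mul_sum, hx'.2, mul_one]
    linarith [abs_add_le (A s s') (∑ sl, B s s' sl * x' sl), hA s s']
  have h2 : ∀ s sl, |∑ s', y s' * B s s' sl| ≤ C * n := by
    intro s sl
    calc |∑ s', y s' * B s s' sl| ≤ ∑ s', |y s' * B s s' sl| := Finset.abs_sum_le_sum_abs _ _
        _ ≤ ∑ s', y s' * (C * n) := by
          refine Finset.sum_le_sum fun s' _ => ?_
          rw [abs_mul, abs_of_nonneg (hy.1 s')]
          exact mul_le_mul_of_nonneg_left
            ((hB _ _ _).trans (mul_le_mul_of_nonneg_left (cc_le _ _) hC)) (hy.1 s')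
        _ = C * n := by rw [← Finset.sum_mul, hy.2, one_mul]
  have e1 : ∑ s, g s * (kk A B x x' s - kk A B y y' s) =
      (∑ s, ∑ s', (A s s' + ∑ sl, B s s' sl * x' sl) * (g s * (x s' - y s'))) +
      ∑ s, ∑ sl, (∑ s', y s' * B s s' sl) * (g s * (x' sl - y' sl)) := by
    rw [← Finset.sum_add_distrib]
    refine Finset.sum_congr rfl fun s _ => ?_
    rw [kk_sub, mul_add, Finset.mul_sum]
    congr 1
    · exact Finset.sum_congr rfl fun s' _ => by ring
    · simp only [Finset.mul_sum, Finset.sum_mul]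
      rw [Finset.sum_comm]
      exact Finset.sum_congr rfl fun s' _ => Finset.sum_congr rfl fun sl _ => by ring
  have am : ∀ (a K p q : ℝ), |a| ≤ K → a * (p * q) ≤ K * ((l * p ^ 2 + q ^ 2 / l) / 2) := by
    intro a K p q h
    calc a * (p * q) ≤ |a * (p * q)| := le_abs_self _
      _ = |a| * (|p| * |q|) := by rw [abs_mul, abs_mul]
      _ ≤ K * ((l * p ^ 2 + q ^ 2 / l) / 2) :=
        mul_le_mul h (amgm hl p q) (by positivity) ((abs_nonneg _).trans h)
  rw [e1]
  refine add_le_add ?_ ?_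
  · calc _ ≤ ∑ s, ∑ s', 2 * C * cc s s' * ((l * g s ^ 2 + (x s' - y s') ^ 2 / l) / 2) :=
          Finset.sum_le_sum fun s _ => Finset.sum_le_sum fun s' _ => am _ _ _ _ (h1 s s')
      _ = ∑ s, ∑ s', cc s s' * (C * l * g s ^ 2) +
            ∑ s, ∑ s', cc s s' * (C * (x s' - y s') ^ 2 / l) := by
          simp only [← Finset.sum_add_distrib]
          exact Finset.sum_congr rfl fun s _ => Finset.sum_congr rfl fun s' _ => by ring
      _ = _ := by
          rw [Finset.sum_comm (f := fun s s' => cc s s' * (C * (x s' - y s') ^ 2 / l))]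
          have : ∀ s' : S, ∑ s : S, cc s s' = 2 * (n - 1) := by
            intro s'; rw [← cc_row s']; exact Finset.sum_congr rfl fun s _ => cc_symm _ _
          simp only [← Finset.sum_mul, cc_row, this, ← hn]
          simp only [← Finset.mul_sum, ← Finset.sum_div]
          ring
  · calc _ ≤ ∑ s, ∑ sl, C * n * ((l * g s ^ 2 + (x' sl - y' sl) ^ 2 / l) / 2) :=
          Finset.sum_le_sum fun s _ => Finset.sum_le_sum fun s' _ => am _ _ _ _ (h2 s s')
      _ = _ := by
          simp only [← Finset.mul_sum, ← Finset.sum_div, Finset.sum_add_distrib,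
            Finset.sum_const, Finset.card_univ, nsmul_eq_mul, ← hn]
          ring
end

lemma gronwall_int {N : ℝ → ℝ} {a L : ℝ} (hL : 0 ≤ L) (hN : BddMeas N)
    (h : ∀ t, 0 ≤ t → N t ≤ a + L * ∫ τ in Ioc (0:ℝ) t, N τ) :
    ∀ t, 0 ≤ t → N t ≤ Real.exp (L * t) * a := by
  have hNi : ∀ b c : ℝ, IntervalIntegrable N volume b c := fun b c =>
    ⟨hN.integrable _, hN.integrable _⟩
  set M : ℝ → ℝ := fun t => a + L * ∫ τ in (0:ℝ)..t, N τ with hM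
  have hMc : Continuous M := by
    have := intervalIntegral.continuous_primitive hNi 0
    fun_prop
  have hNM : ∀ t, 0 ≤ t → N t ≤ M t := by
    intro t ht
    simp only [hM]
    rw [intervalIntegral.integral_of_le ht]; exact h t ht
  set K : ℝ → ℝ := fun t => a + L * ∫ τ in (0:ℝ)..t, M τ with hK
  have hMK : ∀ t, 0 ≤ t → M t ≤ K t := by
    intro t ht
    have := intervalIntegral.integral_mono_on ht (hNi 0 t) (hMc.intervalIntegrable 0 t)
      (fun x hx => hNM x hx.1)
    simp only [hM, hK]
    have := mul_le_mul_of_nonneg_left this hL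
    simp only [hM] at this
    linarith
  have hKd : ∀ t, HasDerivAt K (L * M t) t := by
    intro t
    exact ((intervalIntegral.integral_hasDerivAt_right (hMc.intervalIntegrable 0 t)
      (hMc.stronglyMeasurableAtFilter _ _) hMc.continuousAt).const_mul L).const_add a
  have hK0 : K 0 = a := by simp [hK]
  intro t ht
  have hd : ∀ s, HasDerivAt (fun s => Real.exp (-L * s) * K s)
      (Real.exp (-L * s) * (-L) * K s + Real.exp (-L * s) * (L * M s)) s := by
    intro s
    have h1 : HasDerivAt (fun s : ℝ => Real.exp (-L * s)) (Real.exp (-L * s) * (-L)) s := by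
      simpa using ((hasDerivAt_id s).const_mul (-L)).exp
    exact h1.mul (hKd s)
  have anti : AntitoneOn (fun s => Real.exp (-L * s) * K s) (Ici 0) := by
    refine antitoneOn_of_deriv_nonpos (convex_Ici 0)
      (fun s _ => (hd s).continuousAt.continuousWithinAt)
      (fun s _ => (hd s).differentiableAt.differentiableWithinAt) ?_
    intro s hs
    rw [interior_Ici] at hs
    rw [(hd s).deriv]
    have h1 : M s ≤ K s := hMK s (le_of_lt hs)
    have h2 := mul_le_mul_of_nonneg_left h1 (mul_nonneg (Real.exp_pos (-L * s)).le hL)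
    linarith
  have h3 := anti (mem_Ici.2 le_rfl) (mem_Ici.2 ht) ht
  simp only [mul_zero, Real.exp_zero, one_mul, hK0] at h3
  have h4 : K t ≤ Real.exp (L * t) * a := by
    have := mul_le_mul_of_nonneg_left h3 (Real.exp_pos (L * t)).le
    rwa [← mul_assoc, ← Real.exp_add, show L * t + -L * t = 0 by ring, Real.exp_zero, one_mul]
      at this
  exact (hNM t ht).trans ((hMK t ht).trans h4)

section core
variable {S : Type*} [Fintype S] [DecidableEq S]

/-- drift as an integral of the pointwise kernel -/
noncomputable def Dr (μ : Measure ℝ) (A : ℝ → S → S → ℝ) (B : ℝ → ℝ → S → S → S → ℝ)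
    (x : ℝ → S → ℝ) (u : ℝ) (s : S) : ℝ :=
  ∫ v, kk (A u) (B u v) (x u) (x v) s ∂μ

lemma kk_bddMeas {A : ℝ → S → S → ℝ} {B : ℝ → ℝ → S → S → S → ℝ}
    (hA : ∀ s s', BddMeas fun u => A u s s')
    (hB : ∀ s s' sl, BddMeas fun p : ℝ × ℝ => B p.1 p.2 s s' sl)
    {X : ℝ → ℝ → S → ℝ} (hX : ∀ s, BddMeas fun p : ℝ × ℝ => X p.1 p.2 s) (s : S) :
    BddMeas fun q : (ℝ × ℝ) × ℝ => kk (A q.1.2) (B q.1.2 q.2) (X q.1.1 q.1.2) (X q.1.1 q.2) s := by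
  unfold kk
  have hX1 : ∀ s, BddMeas fun q : (ℝ × ℝ) × ℝ => X q.1.1 q.1.2 s := fun s =>
    (hX s).comp (g := fun q : (ℝ × ℝ) × ℝ => q.1) (by fun_prop)
  have hX2 : ∀ s, BddMeas fun q : (ℝ × ℝ) × ℝ => X q.1.1 q.2 s := fun s =>
    (hX s).comp (g := fun q : (ℝ × ℝ) × ℝ => (q.1.1, q.2)) (by fun_prop)
  have hA1 : ∀ s s', BddMeas fun q : (ℝ × ℝ) × ℝ => A q.1.2 s s' := fun s s' =>
    (hA s s').comp (g := fun q : (ℝ × ℝ) × ℝ => q.1.2) (by fun_prop)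
  have hB1 : ∀ s s' sl, BddMeas fun q : (ℝ × ℝ) × ℝ => B q.1.2 q.2 s s' sl := fun s s' sl =>
    (hB s s' sl).comp (g := fun q : (ℝ × ℝ) × ℝ => (q.1.2, q.2)) (by fun_prop)
  exact (BddMeas.sum fun s' => (hA1 s s').mul (hX1 s')).add
    (BddMeas.sum fun s' => (hX1 s').mul (BddMeas.sum fun sl => (hB1 s s' sl).mul (hX2 sl)))

lemma Dr_bddMeas (μ : Measure ℝ) [IsFiniteMeasure μ]
    {A : ℝ → S → S → ℝ} {B : ℝ → ℝ → S → S → S → ℝ}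
    (hA : ∀ s s', BddMeas fun u => A u s s')
    (hB : ∀ s s' sl, BddMeas fun p : ℝ × ℝ => B p.1 p.2 s s' sl)
    {X : ℝ → ℝ → S → ℝ} (hX : ∀ s, BddMeas fun p : ℝ × ℝ => X p.1 p.2 s) (s : S) :
    BddMeas fun p : ℝ × ℝ => Dr μ A B (X p.1) p.2 s :=
  (kk_bddMeas hA hB hX s).integral μ

lemma Dr_pair_bound (μ : Measure ℝ) [IsProbabilityMeasure μ] {C : ℝ} (hC : 0 ≤ C)
    {A : ℝ → S → S → ℝ} {B : ℝ → ℝ → S → S → S → ℝ}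
    (hA : ∀ s s', BddMeas fun u => A u s s')
    (hB : ∀ s s' sl, BddMeas fun p : ℝ × ℝ => B p.1 p.2 s s' sl)
    (hAb : ∀ u s s', |A u s s'| ≤ C * cc s s')
    (hBb : ∀ u v s s' sl, |B u v s s' sl| ≤ C * cc s s')
    {g x y : ℝ → S → ℝ} (hg : ∀ s, BddMeas fun u => g u s)
    (hx : ∀ s, BddMeas fun u => x u s) (hy : ∀ s, BddMeas fun u => y u s)
    (px : ∀ u, (∀ s, 0 ≤ x u s) ∧ ∑ s, x u s = 1)
    (py : ∀ u, (∀ s, 0 ≤ y u s) ∧ ∑ s, y u s = 1) :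
    ∑ s, ∫ u, g u s * (Dr μ A B x u s - Dr μ A B y u s) ∂μ ≤
      (2 * (C * (Fintype.card S : ℝ) ^ 2)) *
        (√(∑ s, ∫ u, g u s ^ 2 ∂μ) * √(∑ s, ∫ u, (x u s - y u s) ^ 2 ∂μ)) := by
  have hxk : ∀ s, BddMeas fun q : ℝ × ℝ => kk (A q.1) (B q.1 q.2) (x q.1) (x q.2) s := fun s =>
    (kk_bddMeas hA hB (X := fun _ => x) (fun s => (hx s).comp measurable_snd) s).comp
      (g := fun q : ℝ × ℝ => ((0, q.1), q.2)) (by fun_prop)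
  have hyk : ∀ s, BddMeas fun q : ℝ × ℝ => kk (A q.1) (B q.1 q.2) (y q.1) (y q.2) s := fun s =>
    (kk_bddMeas hA hB (X := fun _ => y) (fun s => (hy s).comp measurable_snd) s).comp
      (g := fun q : ℝ × ℝ => ((0, q.1), q.2)) (by fun_prop)
  have hsec : ∀ {f : ℝ × ℝ → ℝ}, BddMeas f → ∀ u, BddMeas fun v => f (u, v) := fun hf u =>
    hf.comp (g := fun v => (u, v)) (by fun_prop)
  have hgk : ∀ s, BddMeas fun q : ℝ × ℝ => g q.1 s * (kk (A q.1) (B q.1 q.2) (x q.1) (x q.2) s -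
      kk (A q.1) (B q.1 q.2) (y q.1) (y q.2) s) := fun s =>
    ((hg s).comp (g := Prod.fst) measurable_fst).mul ((hxk s).sub (hyk s))
  have hgs : BddMeas fun u => ∑ s, g u s ^ 2 := BddMeas.sum fun s => (hg s).sq
  have hds : BddMeas fun u => ∑ s, (x u s - y u s) ^ 2 :=
    BddMeas.sum fun s => ((hx s).sub (hy s)).sq
  refine opt (by positivity) (Finset.sum_nonneg fun s _ => integral_nonneg fun u => sq_nonneg _)
    (Finset.sum_nonneg fun s _ => integral_nonneg fun u => sq_nonneg _) ?_
  intro l hl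
  have e1 : ∑ s, ∫ u, g u s * (Dr μ A B x u s - Dr μ A B y u s) ∂μ =
      ∫ u, ∫ v, ∑ s, g u s * (kk (A u) (B u v) (x u) (x v) s -
        kk (A u) (B u v) (y u) (y v) s) ∂μ ∂μ := by
    have : ∀ u, ∫ v, ∑ s, g u s * (kk (A u) (B u v) (x u) (x v) s -
        kk (A u) (B u v) (y u) (y v) s) ∂μ =
        ∑ s, g u s * (Dr μ A B x u s - Dr μ A B y u s) := by
      intro u
      rw [integral_finsetSum _ fun s _ => (hsec (hgk s) u).integrable μ]
      refine Finset.sum_congr rfl fun s _ => ?_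
      simp only []
      rw [integral_const_mul, integral_sub ((hsec (hxk s) u).integrable μ)
        ((hsec (hyk s) u).integrable μ)]
      rfl
    simp only [this]
    rw [integral_finsetSum]
    intro s _
    exact BddMeas.integrable ((hg s).mul (((hxk s).integral μ).sub ((hyk s).integral μ))) μ
  have hG : ∫ u, ∑ s, g u s ^ 2 ∂μ = ∑ s, ∫ u, g u s ^ 2 ∂μ :=
    integral_finsetSum _ fun s _ => (hg s).sq.integrable μ
  have hD : ∫ u, ∑ s, (x u s - y u s) ^ 2 ∂μ = ∑ s, ∫ u, (x u s - y u s) ^ 2 ∂μ :=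
    integral_finsetSum _ fun s _ => ((hx s).sub (hy s)).sq.integrable μ
  rw [e1, ← hG, ← hD]
  set gs : ℝ → ℝ := fun u => ∑ s, g u s ^ 2 with hgsd
  set ds : ℝ → ℝ := fun u => ∑ s, (x u s - y u s) ^ 2 with hdsd
  set n : ℝ := (Fintype.card S : ℝ) with hn
  have igs := hgs.integrable μ
  have ids := hds.integrable μ
  calc _ ≤ ∫ u, ∫ v, ((4 * C * (n - 1)) * ((l * gs u + ds u / l) / 2) +
          (C * n ^ 2) * ((l * gs u + ds v / l) / 2)) ∂μ ∂μ := by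
        have hup : BddMeas fun q : ℝ × ℝ => ((4 * C * (n - 1)) * ((l * gs q.1 + ds q.1 / l) / 2) +
          (C * n ^ 2) * ((l * gs q.1 + ds q.2 / l) / 2)) := by
          simp only [div_eq_mul_inv]
          have a1 := hgs.comp (g := Prod.fst (α := ℝ) (β := ℝ)) measurable_fst
          have a2 := hds.comp (g := Prod.fst (α := ℝ) (β := ℝ)) measurable_fst
          have a3 := hds.comp (g := Prod.snd (α := ℝ) (β := ℝ)) measurable_snd
          exact ((BddMeas.const _).mul ((((BddMeas.const _).mul a1).add
            (a2.mul (BddMeas.const _))).mul (BddMeas.const _))).add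
            ((BddMeas.const _).mul ((((BddMeas.const _).mul a1).add
            (a3.mul (BddMeas.const _))).mul (BddMeas.const _)))
        have hlow := BddMeas.sum (s := Finset.univ) hgk
        refine integral_mono ((hlow.integral μ).integrable μ) ((hup.integral μ).integrable μ) ?_
        intro u
        refine integral_mono ((hsec hlow u).integrable μ) ((hsec hup u).integrable μ) ?_
        intro v
        exact kk_bound hC (A u) (B u v) (hAb u) (hBb u v) (g u) (x u) (y u) (x v) (y v)
          (py u) (px v) hl
    _ = (4 * C * (n - 1) + C * n ^ 2) * ((l * ∫ u, gs u ∂μ + (∫ u, ds u ∂μ) / l) / 2) := by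
        have i1 : ∀ u, ∫ v, ((4 * C * (n - 1)) * ((l * gs u + ds u / l) / 2) +
          (C * n ^ 2) * ((l * gs u + ds v / l) / 2)) ∂μ =
          (4 * C * (n - 1)) * ((l * gs u + ds u / l) / 2) +
          (C * n ^ 2) * ((l * gs u + (∫ v, ds v ∂μ) / l) / 2) := by
          intro u
          have j0 : Integrable (fun v => (l * gs u + ds v / l) / 2) μ :=
            (((integrable_const _).add (ids.div_const l)).div_const 2)
          rw [integral_add (integrable_const _) (j0.const_mul _), integral_const_mul (C * n ^ 2),
            integral_div 2 (fun v => l * gs u + ds v / l),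
            integral_add (integrable_const _) (ids.div_const l), integral_div]
          simp
        simp only [i1]
        have j1 : Integrable (fun u => (l * gs u + ds u / l) / 2) μ :=
          (((igs.const_mul l).add (ids.div_const l)).div_const 2)
        have j2 : Integrable (fun u => (l * gs u + (∫ v, ds v ∂μ) / l) / 2) μ :=
          (((igs.const_mul l).add (integrable_const _)).div_const 2)
        rw [integral_add (j1.const_mul _) (j2.const_mul _), integral_const_mul,
          integral_const_mul, integral_div, integral_div,
          integral_add (igs.const_mul l) (ids.div_const l),
          integral_add (igs.const_mul l) (integrable_const _), integral_div, integral_const_mul]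
        simp
        ring
    _ ≤ _ := by
        have p1 : 0 ≤ ∫ u, gs u ∂μ := integral_nonneg fun u =>
          Finset.sum_nonneg fun s _ => sq_nonneg _
        have p2 : 0 ≤ ∫ u, ds u ∂μ := integral_nonneg fun u =>
          Finset.sum_nonneg fun s _ => sq_nonneg _
        refine mul_le_mul_of_nonneg_right ?_ (by positivity)
        nlinarith [mul_nonneg hC (sq_nonneg (n - 2))]

lemma core (μ : Measure ℝ) [IsProbabilityMeasure μ] {C : ℝ} (hC : 0 ≤ C)
    {A : ℝ → S → S → ℝ} {B : ℝ → ℝ → S → S → S → ℝ}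
    (hA : ∀ s s', BddMeas fun u => A u s s')
    (hB : ∀ s s' sl, BddMeas fun p : ℝ × ℝ => B p.1 p.2 s s' sl)
    (hAb : ∀ u s s', |A u s s'| ≤ C * cc s s')
    (hBb : ∀ u v s s' sl, |B u v s s' sl| ≤ C * cc s s')
    {x₀ y₀ : ℝ → S → ℝ} {X Y : ℝ → ℝ → S → ℝ}
    (hx₀ : ∀ s, BddMeas fun u => x₀ u s) (hy₀ : ∀ s, BddMeas fun u => y₀ u s)
    (hX : ∀ s, BddMeas fun p : ℝ × ℝ => X p.1 p.2 s)
    (hY : ∀ s, BddMeas fun p : ℝ × ℝ => Y p.1 p.2 s)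
    (pX : ∀ t u, (∀ s, 0 ≤ X t u s) ∧ ∑ s, X t u s = 1)
    (pY : ∀ t u, (∀ s, 0 ≤ Y t u s) ∧ ∑ s, Y t u s = 1)
    (eX : ∀ t, 0 ≤ t → ∀ᵐ u ∂μ, ∀ s,
      X t u s = x₀ u s + ∫ τ in Ioc (0:ℝ) t, Dr μ A B (X τ) u s)
    (eY : ∀ t, 0 ≤ t → ∀ᵐ u ∂μ, ∀ s,
      Y t u s = y₀ u s + ∫ τ in Ioc (0:ℝ) t, Dr μ A B (Y τ) u s) :
    ∀ t, 0 ≤ t → √(∑ s, ∫ u, (X t u s - Y t u s) ^ 2 ∂μ) ≤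
      Real.exp ((2 * (C * (Fintype.card S : ℝ) ^ 2)) * t) *
        √(∑ s, ∫ u, (x₀ u s - y₀ u s) ^ 2 ∂μ) := by
  set L : ℝ := 2 * (C * (Fintype.card S : ℝ) ^ 2) with hL
  have hL0 : 0 ≤ L := by positivity
  have hXY : ∀ s, BddMeas fun p : ℝ × ℝ => X p.1 p.2 s - Y p.1 p.2 s := fun s => (hX s).sub (hY s)
  have hE : BddMeas fun t => ∑ s, ∫ u, (X t u s - Y t u s) ^ 2 ∂μ :=
    BddMeas.sum fun s => (hXY s).sq.integral μ
  have hE0 : ∀ t, 0 ≤ ∑ s, ∫ u, (X t u s - Y t u s) ^ 2 ∂μ := fun t =>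
    Finset.sum_nonneg fun s _ => integral_nonneg fun u => sq_nonneg _
  have hN : BddMeas fun t => √(∑ s, ∫ u, (X t u s - Y t u s) ^ 2 ∂μ) := by
    refine ⟨hE.1.sqrt, ?_⟩
    obtain ⟨M, hM⟩ := hE.2
    refine ⟨√M, fun t => ?_⟩
    rw [abs_of_nonneg (Real.sqrt_nonneg _)]
    exact Real.sqrt_le_sqrt ((le_abs_self _).trans (hM t))
  refine gronwall_int hL0 hN ?_
  intro t ht
  set N : ℝ → ℝ := fun t => √(∑ s, ∫ u, (X t u s - Y t u s) ^ 2 ∂μ) with hNd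
  set a : ℝ := √(∑ s, ∫ u, (x₀ u s - y₀ u s) ^ 2 ∂μ) with ha
  change N t ≤ _
  have hsec : ∀ {f : ℝ × ℝ → ℝ}, BddMeas f → ∀ u, BddMeas fun v => f (u, v) := fun hf u =>
    hf.comp (g := fun v => (u, v)) (by fun_prop)
  have hsec' : ∀ {f : ℝ × ℝ → ℝ}, BddMeas f → ∀ v, BddMeas fun u => f (u, v) := fun hf v =>
    hf.comp (g := fun u => (u, v)) (by fun_prop)
  have hg : ∀ s, BddMeas fun u => X t u s - Y t u s := fun s => hsec (hXY s) t
  have hDX := fun s => Dr_bddMeas μ hA hB hX s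
  have hDY := fun s => Dr_bddMeas μ hA hB hY s
  have hH : ∀ s, BddMeas fun p : ℝ × ℝ => Dr μ A B (X p.1) p.2 s - Dr μ A B (Y p.1) p.2 s :=
    fun s => (hDX s).sub (hDY s)
  have hgH : ∀ s, BddMeas fun p : ℝ × ℝ => (X t p.1 s - Y t p.1 s) *
      (Dr μ A B (X p.2) p.1 s - Dr μ A B (Y p.2) p.1 s) := fun s =>
    ((hg s).comp (g := Prod.fst) measurable_fst).mul ((hH s).comp (g := Prod.swap) measurable_swap)
  have key : ∑ s, ∫ u, (X t u s - Y t u s) ^ 2 ∂μ =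
      (∑ s, ∫ u, (X t u s - Y t u s) * (x₀ u s - y₀ u s) ∂μ) +
      ∫ τ in Ioc (0:ℝ) t, ∑ s, ∫ u, (X t u s - Y t u s) *
        (Dr μ A B (X τ) u s - Dr μ A B (Y τ) u s) ∂μ := by
    have hsw : ∀ s, BddMeas fun τ => ∫ u, (X t u s - Y t u s) *
        (Dr μ A B (X τ) u s - Dr μ A B (Y τ) u s) ∂μ := fun s =>
      BddMeas.integral (f := fun p : ℝ × ℝ => (X t p.2 s - Y t p.2 s) *
        (Dr μ A B (X p.1) p.2 s - Dr μ A B (Y p.1) p.2 s))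
        ((hgH s).comp (g := Prod.swap) measurable_swap) μ
    rw [integral_finsetSum _ fun s _ => (hsw s).integrable _, ← Finset.sum_add_distrib]
    refine Finset.sum_congr rfl fun s _ => ?_
    rw [← integral_integral_swap (μ := μ) (ν := volume.restrict (Ioc 0 t))
      (f := fun u τ => (X t u s - Y t u s) * (Dr μ A B (X τ) u s - Dr μ A B (Y τ) u s))
      ((hgH s).integrable _), ← integral_add (((hg s).mul ((hx₀ s).sub (hy₀ s))).integrable μ)
      (((hgH s).integral _).integrable μ)]
    refine integral_congr_ae ?_
    filter_upwards [eX t ht, eY t ht] with u h1 h2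
    rw [integral_const_mul, integral_sub ((hsec' (hDX s) u).integrable _)
      ((hsec' (hDY s) u).integrable _), ← mul_add, pow_two]
    congr 1
    rw [h1 s, h2 s]; ring
  have b1 : ∑ s, ∫ u, (X t u s - Y t u s) * (x₀ u s - y₀ u s) ∂μ ≤ N t * a := by
    have := opt (X := ∑ s, ∫ u, (X t u s - Y t u s) * (x₀ u s - y₀ u s) ∂μ) zero_le_one (hE0 t)
      (B := ∑ s, ∫ u, (x₀ u s - y₀ u s) ^ 2 ∂μ)
      (Finset.sum_nonneg fun s _ => integral_nonneg fun u => sq_nonneg _) ?_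
    · simpa using this
    intro l hl
    rw [one_mul, Finset.mul_sum, Finset.sum_div, ← Finset.sum_add_distrib, Finset.sum_div]
    refine Finset.sum_le_sum fun s _ => ?_
    have i1 := (hg s).sq.integrable μ
    have i2 := ((hx₀ s).sub (hy₀ s)).sq.integrable μ
    rw [← integral_const_mul, ← integral_div, ← integral_add (i1.const_mul l) (i2.div_const l),
      ← integral_div]
    refine integral_mono (((hg s).mul ((hx₀ s).sub (hy₀ s))).integrable μ)
      (((i1.const_mul l).add (i2.div_const l)).div_const 2) fun u => ?_
    refine le_trans ?_ (amgm hl _ _)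
    rw [← abs_mul]; exact le_abs_self _
  have b2 : ∫ τ in Ioc (0:ℝ) t, ∑ s, ∫ u, (X t u s - Y t u s) *
        (Dr μ A B (X τ) u s - Dr μ A B (Y τ) u s) ∂μ ≤ N t * (L * ∫ τ in Ioc (0:ℝ) t, N τ) := by
    rw [← integral_const_mul, ← integral_const_mul]
    refine integral_mono (BddMeas.integrable (BddMeas.sum fun s => ?_) _)
      (((hN.integrable _).const_mul _).const_mul _) fun τ => ?_
    · exact BddMeas.integral (f := fun p : ℝ × ℝ => (X t p.2 s - Y t p.2 s) *
        (Dr μ A B (X p.1) p.2 s - Dr μ A B (Y p.1) p.2 s))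
        ((hgH s).comp (g := Prod.swap) measurable_swap) μ
    · have := Dr_pair_bound μ hC hA hB hAb hBb (g := fun u s => X t u s - Y t u s) hg
        (fun s => hsec (hX s) τ) (fun s => hsec (hY s) τ) (pX τ) (pY τ)
      refine this.trans (le_of_eq ?_)
      simp only [hNd, hL]
      ring
  have hNN : N t * N t = ∑ s, ∫ u, (X t u s - Y t u s) ^ 2 ∂μ := Real.mul_self_sqrt (hE0 t)
  have hNt : 0 ≤ N t := Real.sqrt_nonneg _
  rcases hNt.eq_or_lt with h0 | h0
  · rw [← h0]
    have : 0 ≤ ∫ τ in Ioc (0:ℝ) t, N τ := integral_nonneg fun τ => Real.sqrt_nonneg _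
    have : 0 ≤ a := Real.sqrt_nonneg _
    positivity
  · refine le_of_mul_le_mul_left ?_ h0
    rw [hNN, key, mul_add]
    exact add_le_add b1 b2
end core

section final
variable {S : Type*} [Fintype S]

def GoodVec (x : S → ℝ) : Prop := (∀ s, 0 ≤ x s) ∧ ∑ s, x s = 1

open Classical in
/-- replace non-probability vectors by the uniform vector -/
noncomputable def cleanVec (x : S → ℝ) : S → ℝ :=
  if GoodVec x then x else fun _ => 1 / (Fintype.card S : ℝ)

lemma cleanVec_eq {x : S → ℝ} (h : GoodVec x) : cleanVec x = x := if_pos h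

lemma cleanVec_good [Nonempty S] (x : S → ℝ) : GoodVec (cleanVec x) := by
  by_cases h : GoodVec x
  · rwa [cleanVec_eq h]
  · rw [cleanVec, if_neg h]
    refine ⟨fun _ => by positivity, ?_⟩
    simp

lemma GoodVec.le_one {x : S → ℝ} (h : GoodVec x) (s : S) : |x s| ≤ 1 := by
  rw [abs_of_nonneg (h.1 s), ← h.2]
  exact Finset.single_le_sum (fun i _ => h.1 i) (Finset.mem_univ s)

lemma measurableSet_good : MeasurableSet {x : S → ℝ | GoodVec x} := by
  have : {x : S → ℝ | GoodVec x} = (⋂ s, {x | 0 ≤ x s}) ∩ {x | ∑ s, x s = 1} := by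
    ext x; simp [GoodVec]
  rw [this]
  refine (MeasurableSet.iInter fun s => measurableSet_le measurable_const (measurable_pi_apply s)).inter
    (measurableSet_eq_fun (by fun_prop) measurable_const)

lemma measurable_clean : Measurable (cleanVec : (S → ℝ) → S → ℝ) := by
  classical
  exact Measurable.ite measurableSet_good measurable_id measurable_const

lemma bddMeas_clean [Nonempty S] {α : Type*} [MeasurableSpace α] {x : α → S → ℝ}
    (hx : ∀ s, Measurable fun a => x a s) (s : S) : BddMeas fun a => cleanVec (x a) s :=
  ⟨(measurable_pi_apply s).comp (measurable_clean.comp (measurable_pi_lambda _ hx)), 1,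
    fun a => (cleanVec_good (x a)).le_one s⟩

variable [DecidableEq S]

lemma Runi_bound {C : ℝ} {runi : ℝ → S → S → ℝ} (h : ∀ u s s', runi u s s' ∈ Icc (0:ℝ) C)
    (u : ℝ) (s s' : S) : |RuniOf runi u s s'| ≤ C * cc s s' := by
  unfold RuniOf cc
  split_ifs
  · rw [abs_neg, abs_of_nonneg (Finset.sum_nonneg fun i _ => (h u s i).1)]
    refine (Finset.sum_le_card_nsmul _ _ C fun i _ => (h u s i).2).trans (le_of_eq ?_)
    have := card_one_le s
    rw [Finset.card_erase_of_mem (Finset.mem_univ s), nsmul_eq_mul, Finset.card_univ,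
      Nat.cast_sub (by exact_mod_cast this)]
    push_cast; ring
  · rw [abs_of_nonneg (h u s' s).1, mul_one]; exact (h u s' s).2

lemma Rpair_bound {C : ℝ} {rpair : ℝ → ℝ → S → S → S → ℝ}
    (h : ∀ u v s s' sl, rpair u v s s' sl ∈ Icc (0:ℝ) C)
    (u v : ℝ) (s s' sl : S) : |RpairOf rpair u v s s' sl| ≤ C * cc s s' :=
  Runi_bound (runi := fun _ s s' => rpair u v s s' sl) (fun _ s s' => h u v s s' sl) u s s'

lemma Dr_eq (μ : Measure ℝ) [IsProbabilityMeasure μ]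
    {A : ℝ → S → S → ℝ} {B : ℝ → ℝ → S → S → S → ℝ}
    (hB : ∀ s s' sl, BddMeas fun p : ℝ × ℝ => B p.1 p.2 s s' sl)
    {x : ℝ → S → ℝ} (hx : ∀ s, BddMeas fun u => x u s) (u : ℝ) (s : S) :
    Dr μ A B x u s = (∑ s', A u s s' * x u s') +
      ∑ s', x u s' * ∫ v, ∑ sl, B u v s s' sl * x v sl ∂μ := by
  unfold Dr kk
  have h1 : ∀ s', Integrable (fun v => ∑ sl, B u v s s' sl * x v sl) μ := fun s' =>
    BddMeas.integrable (BddMeas.sum fun sl =>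
      ((hB s s' sl).comp (g := fun v : ℝ => (u, v)) (by fun_prop)).mul (hx sl)) μ
  rw [integral_add (integrable_const _) (integrable_finsetSum _ fun s' _ => (h1 s').const_mul _),
    integral_finsetSum _ fun s' _ => (h1 s').const_mul _]
  simp [integral_const_mul]

lemma clean_eqn [Nonempty S] {G : ℝ → ℝ → ℝ}
    (hG01 : ∀ u ∈ Ioc (0:ℝ) 1, ∀ v ∈ Ioc (0:ℝ) 1, G u v ∈ Icc (0:ℝ) 1)
    {A : ℝ → S → S → ℝ} {R : ℝ → ℝ → S → S → S → ℝ}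
    (hB : ∀ s s' sl, BddMeas fun p : ℝ × ℝ => R p.1 p.2 s s' sl * max 0 (min 1 (G p.1 p.2)))
    {x₀ : ℝ → S → ℝ}
    (hx₀ : ∀ᵐ u ∂(volume.restrict (Ioc (0:ℝ) 1)), (∀ s, 0 ≤ x₀ u s) ∧ ∑ s, x₀ u s = 1)
    {φ : ℝ → ℝ → S → ℝ} (hφ : IsMFSolution G A R x₀ φ) (t : ℝ) (ht : 0 ≤ t) :
    ∀ᵐ u ∂(volume.restrict (Ioc (0:ℝ) 1)), ∀ s,
      cleanVec (φ t u) s = cleanVec (x₀ u) s + ∫ τ in Ioc (0:ℝ) t,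
        Dr (volume.restrict (Ioc (0:ℝ) 1)) A
          (fun u v s s' sl => R u v s s' sl * max 0 (min 1 (G u v)))
          (fun u => cleanVec (φ τ u)) u s := by
  obtain ⟨hm, hp, he, -⟩ := hφ
  have : IsProbabilityMeasure (volume.restrict (Ioc (0:ℝ) 1)) := ⟨by simp⟩
  have hmv : Measurable fun p : ℝ × ℝ => φ p.1 p.2 := measurable_pi_lambda _ hm
  have hsw : ∀ᵐ u ∂(volume.restrict (Ioc (0:ℝ) 1)), ∀ᵐ τ ∂(volume.restrict (Ioc (0:ℝ) t)),
      GoodVec (φ τ u) := by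
    rw [Measure.ae_ae_comm (p := fun u τ => GoodVec (φ τ u))]
    · filter_upwards [ae_restrict_mem measurableSet_Ioc] with τ hτ
      exact hp τ hτ.1.le
    · exact (hmv.comp measurable_swap) measurableSet_good
  filter_upwards [hsw, hx₀, hp t ht, he t ht, ae_restrict_mem measurableSet_Ioc]
    with u h1 h2 h3 h4 hu s
  rw [cleanVec_eq (x := φ t u) h3, cleanVec_eq (x := x₀ u) h2, h4 s]
  congr 1
  refine integral_congr_ae ?_
  filter_upwards [h1, ae_restrict_mem measurableSet_Ioc] with τ hg hτ
  rw [Dr_eq _ hB (x := fun u => cleanVec (φ τ u)) (fun s => bddMeas_clean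
    (fun s => (hm s).comp (measurable_const.prodMk measurable_id)) s)]
  unfold graphonDrift
  simp only [cleanVec_eq hg]
  congr 1
  refine Finset.sum_congr rfl fun s' _ => ?_
  congr 1
  refine integral_congr_ae ?_
  filter_upwards [hp τ hτ.1.le, ae_restrict_mem measurableSet_Ioc] with v hv hv'
  have hG := hG01 u hu v hv'
  rw [cleanVec_eq (x := φ τ v) hv, min_eq_right hG.2, max_eq_right hG.1]

lemma l2_clean {x y : ℝ → S → ℝ}
    (hx : ∀ᵐ u ∂(volume.restrict (Ioc (0:ℝ) 1)), (∀ s, 0 ≤ x u s) ∧ ∑ s, x u s = 1)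
    (hy : ∀ᵐ u ∂(volume.restrict (Ioc (0:ℝ) 1)), (∀ s, 0 ≤ y u s) ∧ ∑ s, y u s = 1) :
    l2norm (fun u s => x u s - y u s) =
      √(∑ s, ∫ u in Ioc (0:ℝ) 1, (cleanVec (x u) s - cleanVec (y u) s) ^ 2) := by
  unfold l2norm
  congr 1
  refine Finset.sum_congr rfl fun s _ => integral_congr_ae ?_
  filter_upwards [hx, hy] with u h1 h2
  rw [cleanVec_eq (x := x u) h1, cleanVec_eq (x := y u) h2]

end final

/-- Lipschitz dependence of the graphon mean field flow on the initial condition: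
`‖φ(t,x₀) − φ(t,y₀)‖_{L₂} ≤ e^{L_F t} ‖x₀ − y₀‖_{L₂}` with
`L_F = 2(C_R|S|² + 2C_R|S|³|||G|||)`. -/
theorem graphon_mfe_initial_condition_lipschitz {S : Type*} [Fintype S] [Nonempty S]
    [DecidableEq S]
    (G : ℝ → ℝ → ℝ) (hGmeas : Measurable fun p : ℝ × ℝ => G p.1 p.2)
    (hG01 : ∀ u ∈ Ioc (0:ℝ) 1, ∀ v ∈ Ioc (0:ℝ) 1, G u v ∈ Icc (0:ℝ) 1)
    (C_R : ℝ) (hCR : 0 ≤ C_R)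
    (runi : ℝ → S → S → ℝ) (rpair : ℝ → ℝ → S → S → S → ℝ)
    (hruniMeas : ∀ s s', Measurable fun u => runi u s s')
    (hrpairMeas : ∀ s s' sl, Measurable fun p : ℝ × ℝ => rpair p.1 p.2 s s' sl)
    (hruni : ∀ u s s', runi u s s' ∈ Icc (0:ℝ) C_R)
    (hrpair : ∀ u v s s' sl, rpair u v s s' sl ∈ Icc (0:ℝ) C_R)
    (x₀ y₀ : ℝ → S → ℝ)
    (hx₀meas : ∀ s, Measurable fun u => x₀ u s)
    (hy₀meas : ∀ s, Measurable fun u => y₀ u s)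
    (hx₀prob : ∀ᵐ u ∂(volume.restrict (Ioc (0:ℝ) 1)),
      (∀ s, 0 ≤ x₀ u s) ∧ ∑ s, x₀ u s = 1)
    (hy₀prob : ∀ᵐ u ∂(volume.restrict (Ioc (0:ℝ) 1)),
      (∀ s, 0 ≤ y₀ u s) ∧ ∑ s, y₀ u s = 1)
    (φ ψ : ℝ → ℝ → S → ℝ)
    (hφ : IsMFSolution G (RuniOf runi) (RpairOf rpair) x₀ φ)
    (hψ : IsMFSolution G (RuniOf runi) (RpairOf rpair) y₀ ψ) :
    ∀ t, 0 ≤ t →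
      l2norm (fun u s => φ t u s - ψ t u s) ≤
        Real.exp ((2 * (C_R * (Fintype.card S : ℝ) ^ 2 +
            2 * C_R * (Fintype.card S : ℝ) ^ 3 * graphonOpNorm G)) * t) *
          l2norm (fun u s => x₀ u s - y₀ u s) := by
  obtain ⟨s₀⟩ := ‹Nonempty S›
  have : Nonempty S := ⟨s₀⟩
  have hprob : IsProbabilityMeasure (volume.restrict (Ioc (0:ℝ) 1)) := ⟨by simp⟩
  have hA : ∀ s s', BddMeas fun u => RuniOf runi u s s' := by
    intro s s'
    refine ⟨?_, C_R * cc s s', fun u => Runi_bound hruni u s s'⟩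
    unfold RuniOf
    split_ifs
    · exact (Finset.measurable_fun_sum _ fun i _ => hruniMeas s i).neg
    · exact hruniMeas s' s
  have hGb : ∀ u v, 0 ≤ max 0 (min 1 (G u v)) ∧ max 0 (min 1 (G u v)) ≤ 1 := fun u v =>
    ⟨le_max_left _ _, max_le zero_le_one (min_le_left _ _)⟩
  have hBb : ∀ u v s s' sl,
      |RpairOf rpair u v s s' sl * max 0 (min 1 (G u v))| ≤ C_R * cc s s' := by
    intro u v s s' sl
    rw [abs_mul, abs_of_nonneg (hGb u v).1]
    have h1 := Rpair_bound hrpair u v s s' sl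
    exact (mul_le_of_le_one_right (abs_nonneg _) (hGb u v).2).trans h1
  have hB : ∀ s s' sl, BddMeas fun p : ℝ × ℝ =>
      RpairOf rpair p.1 p.2 s s' sl * max 0 (min 1 (G p.1 p.2)) := by
    intro s s' sl
    refine ⟨?_, C_R * cc s s', fun p => hBb p.1 p.2 s s' sl⟩
    refine Measurable.mul ?_ (measurable_const.max (measurable_const.min hGmeas))
    unfold RpairOf
    split_ifs
    · exact (Finset.measurable_fun_sum _ fun i _ => hrpairMeas s i sl).neg
    · exact hrpairMeas s' s sl
  intro t ht
  have main := core (volume.restrict (Ioc (0:ℝ) 1)) hCR hA hB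
    (fun u s s' => Runi_bound hruni u s s') hBb
    (fun s => bddMeas_clean hx₀meas s) (fun s => bddMeas_clean hy₀meas s)
    (X := fun t u => cleanVec (φ t u)) (Y := fun t u => cleanVec (ψ t u))
    (fun s => bddMeas_clean (x := fun p : ℝ × ℝ => φ p.1 p.2) hφ.1 s)
    (fun s => bddMeas_clean (x := fun p : ℝ × ℝ => ψ p.1 p.2) hψ.1 s)
    (fun t u => cleanVec_good _) (fun t u => cleanVec_good _)
    (clean_eqn hG01 hB hx₀prob hφ) (clean_eqn hG01 hB hy₀prob hψ) t ht
  rw [l2_clean (hφ.2.1 t ht) (hψ.2.1 t ht), l2_clean hx₀prob hy₀prob]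
  refine main.trans (mul_le_mul_of_nonneg_right (Real.exp_le_exp.2 ?_) (Real.sqrt_nonneg _))
  refine mul_le_mul_of_nonneg_right ?_ ht
  have hop : 0 ≤ graphonOpNorm G := by
    refine Real.sSup_nonneg ?_
    rintro r ⟨f, -, -, rfl⟩
    exact Real.sqrt_nonneg _
  have : 0 ≤ 2 * C_R * (Fintype.card S : ℝ) ^ 3 * graphonOpNorm G := by positivity
  linarith
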